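/- Let N ≥ 1 and let G be a closed connected subgroup of U(N). Let a, b ∈ G be involutions (a² = 1, b² = 1) such that a·g·b·g⁻¹ has finite order for every g ∈ G. Then a and b commute: a·b = b·a. -/

import Mathlib

section Helpers
open scoped Matrix.Norms.L2Operator Matrix ComplexOrder
open Filter Topology

/-- The unitary group as a type. -/
abbrev UN (N : ℕ) := ↥(Matrix.unitaryGroup (Fin N) ℂ)

/-- Energy of a unitary matrix. -/
noncomputable def en {N : ℕ} (u : UN N) : ℝ := N - (Matrix.trace (u : Matrix (Fin N) (Fin N) ℂ)).re

lemma UN_norm_le {N : ℕ} (u : UN N) : ‖(u : Matrix (Fin N) (Fin N) ℂ)‖ ≤ 1 := by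
  have h := CStarRing.norm_coe_unitary_mul u 1
  rcases Nat.eq_zero_or_pos N with h0 | h0
  · subst h0
    have : (u : Matrix (Fin 0) (Fin 0) ℂ) = 0 := Subsingleton.elim _ _
    rw [this]; simp
  · have : Nonempty (Fin N) := ⟨⟨0, h0⟩⟩
    rw [mul_one] at h
    rw [h, norm_one]

lemma UN_compact (N : ℕ) : CompactSpace (UN N) := by
  refine (isCompact_iff_compactSpace (s := ((Matrix.unitaryGroup (Fin N) ℂ : Submonoid _) : Set (Matrix (Fin N) (Fin N) ℂ)))).1 ?_
  refine Metric.isCompact_of_isClosed_isBounded ?_ ?_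
  · have : ((Matrix.unitaryGroup (Fin N) ℂ : Submonoid _) : Set (Matrix (Fin N) (Fin N) ℂ))
      = {A | A * star A = 1} := by
      ext A; exact Matrix.mem_unitaryGroup_iff
    rw [this]
    exact isClosed_eq (by fun_prop) (by fun_prop)
  · rw [isBounded_iff_forall_norm_le]
    exact ⟨1, fun A hA => UN_norm_le ⟨A, hA⟩⟩

lemma en_eq {N : ℕ} (u : UN N) :
    2 * en u = (Matrix.trace (((u : Matrix (Fin N) (Fin N) ℂ) - 1)ᴴ * ((u : Matrix (Fin N) (Fin N) ℂ) - 1))).re := by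
  have h : (u : Matrix (Fin N) (Fin N) ℂ)ᴴ * (u : Matrix (Fin N) (Fin N) ℂ) = 1 :=
    Matrix.mem_unitaryGroup_iff'.1 u.2
  rw [Matrix.conjTranspose_sub, Matrix.conjTranspose_one, sub_mul, mul_sub, mul_sub, h]
  simp only [mul_one, one_mul, Matrix.trace_sub, Matrix.trace_one, Matrix.trace_conjTranspose,
    Complex.sub_re, en, Fintype.card_fin, Complex.natCast_re, Complex.star_def, Complex.conj_re]
  ring

lemma trace_cTm_re_im {N : ℕ} (A : Matrix (Fin N) (Fin N) ℂ) :
    0 ≤ (Matrix.trace (Aᴴ * A)).re ∧ (Matrix.trace (Aᴴ * A)).im = 0 := by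
  have h := (Matrix.posSemidef_conjTranspose_mul_self A).trace_nonneg
  rw [Complex.le_def] at h
  exact ⟨h.1, h.2.symm⟩

lemma eq_zero_of_trace_re {N : ℕ} (A : Matrix (Fin N) (Fin N) ℂ)
    (h : (Matrix.trace (Aᴴ * A)).re = 0) : A = 0 := by
  rw [← Matrix.trace_conjTranspose_mul_self_eq_zero_iff]
  exact Complex.ext h (trace_cTm_re_im A).2

lemma en_nonneg {N : ℕ} (u : UN N) : 0 ≤ en u := by
  have h := en_eq u
  have h2 := (trace_cTm_re_im ((u : Matrix (Fin N) (Fin N) ℂ) - 1)).1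
  linarith

lemma en_eq_zero {N : ℕ} (u : UN N) (h0 : en u = 0) : u = 1 := by
  have h := en_eq u
  rw [h0, mul_zero] at h
  have := eq_zero_of_trace_re _ h.symm
  exact Subtype.ext (sub_eq_zero.1 this)

lemma en_one {N : ℕ} : en (1 : UN N) = 0 := by
  simp [en]

lemma en_inv {N : ℕ} (u : UN N) : en u⁻¹ = en u := by
  have : ((u⁻¹ : UN N) : Matrix (Fin N) (Fin N) ℂ) = (u : Matrix (Fin N) (Fin N) ℂ)ᴴ := rfl
  rw [en, en, this, Matrix.trace_conjTranspose]
  simp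

lemma en_continuous {N : ℕ} : Continuous (en : UN N → ℝ) := by
  unfold en
  have : Continuous fun u : UN N => Matrix.trace (u : Matrix (Fin N) (Fin N) ℂ) :=
    continuous_subtype_val.matrix_trace
  fun_prop

/-- Small energy implies small norm distance to `1`. -/
lemma en_small {N : ℕ} (V : Set (UN N)) (hV : V ∈ 𝓝 1) :
    ∃ ε > 0, ∀ u : UN N, en u < ε → u ∈ V := by
  have := UN_compact N
  have hK : IsCompact (interior V)ᶜ := isOpen_interior.isClosed_compl.isCompact
  rcases (interior V)ᶜ.eq_empty_or_nonempty with he | hne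
  · refine ⟨1, one_pos, fun u _ => interior_subset ?_⟩
    rw [Set.compl_empty_iff] at he
    rw [he]; trivial
  · obtain ⟨x, hx, hmin⟩ := hK.exists_isMinOn hne en_continuous.continuousOn
    refine ⟨en x, ?_, ?_⟩
    · refine lt_of_le_of_ne (en_nonneg x) fun h => hx ?_
      rw [en_eq_zero x h.symm]
      exact mem_interior_iff_mem_nhds.2 hV
    · intro u hu
      by_contra hn
      have := hmin (show u ∈ (interior V)ᶜ from fun h => hn (interior_subset h))
      exact absurd hu (not_lt.2 this)

/-- Traces of finite-order unitary matrices form a countable set. -/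
lemma countable_traces (N : ℕ) :
    (en '' {u : UN N | IsOfFinOrder u}).Countable := by
  let R : Set ℂ := {z | ∃ n : ℕ, 0 < n ∧ z ^ n = 1}
  have hR : R.Countable := by
    have : R ⊆ ⋃ n : ℕ, ((Polynomial.X ^ (n + 1) - Polynomial.C 1 : Polynomial ℂ).rootSet ℂ) := by
      rintro z ⟨n, hn, hz⟩
      refine Set.mem_iUnion.2 ⟨n - 1, ?_⟩
      rw [Nat.sub_add_cancel hn, Polynomial.mem_rootSet]
      refine ⟨Polynomial.X_pow_sub_C_ne_zero hn 1, ?_⟩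
      simp [hz]
    refine Set.Countable.mono this (Set.countable_iUnion fun n => ?_)
    exact (Polynomial.rootSet_finite _ _).countable
  have : Countable R := hR
  let F : Multiset R → ℝ := fun s => N - ((s.map Subtype.val).sum).re
  refine (Set.countable_range F).mono ?_
  rintro _ ⟨u, hu, rfl⟩
  obtain ⟨n, hn, hun⟩ := isOfFinOrder_iff_pow_eq_one.1 hu
  let A : Matrix (Fin N) (Fin N) ℂ := u
  have hA : A ^ n = 1 := by
    have := congrArg (Subtype.val) hun
    simpa using this
  have hroots : ∀ z ∈ A.charpoly.roots, z ∈ R := by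
    intro z hz
    have h1 : z ∈ spectrum ℂ A :=
      Matrix.mem_spectrum_iff_isRoot_charpoly.2 (Polynomial.isRoot_of_mem_roots hz)
    have h2 := spectrum.pow_mem_pow A n h1
    rw [hA] at h2
    refine ⟨n, hn, ?_⟩
    rcases Nat.eq_zero_or_pos N with h0 | h0
    · subst h0
      exfalso
      simp [spectrum.of_subsingleton] at h1
    · have : Nonempty (Fin N) := ⟨⟨0, h0⟩⟩
      rw [spectrum.one_eq] at h2
      exact h2
  refine ⟨A.charpoly.roots.pmap (fun z hz => ⟨z, hz⟩) hroots, ?_⟩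
  simp only [F, en]
  rw [Multiset.map_pmap, Multiset.pmap_eq_map, Multiset.map_id', ← Matrix.trace_eq_sum_roots_charpoly]

/-- Final step of the argument. -/
lemma final_step {N : ℕ} (a b : UN N) (ha : a ^ 2 = 1) (hb : b ^ 2 = 1) (A : Set (UN N))
    (hA : IsPreconnected A) (h1 : 1 ∈ A) (hu : a * b ∈ A) (hc : ∀ h ∈ A, Commute h (a * b))
    (hfin : ∀ g ∈ A, IsOfFinOrder (a * g * b * g⁻¹)) : a * b = b * a := by
  have ha' : a * a = 1 := by rw [← sq, ha]
  have hb' : b * b = 1 := by rw [← sq, hb]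
  have hai : a⁻¹ = a := inv_eq_of_mul_eq_one_left ha'
  have hbi : b⁻¹ = b := inv_eq_of_mul_eq_one_left hb'
  have hw : ∀ h ∈ A, IsOfFinOrder (a * h * a * h⁻¹) := by
    intro h hh
    have c1 : Commute (h⁻¹) (a * b) := (hc h hh).inv_left
    have c2 : Commute (a * h * a) (a * b) := by
      have e : h * (b * a) = (b * a) * h := by
        have := (hc h hh).inv_right
        rwa [mul_inv_rev, hai, hbi] at this
      have e2 : a * h * a * (b * a) = a * (h * (a * b)) * a := by group
      have c : Commute (a * h * a) (b * a) := by
        show a * h * a * (b * a) = b * a * (a * h * a)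
        rw [e2, (hc h hh).eq]
        calc a * (a * b * h) * a = (a * a) * (b * h * a) := by group
          _ = b * (a * a) * h * a := by rw [ha']; group
          _ = _ := by group
      have := c.inv_right
      rwa [mul_inv_rev, hai, hbi] at this
    have e : a * h * b * h⁻¹ = (a * h * a * h⁻¹) * (a * b) := by
      calc a * h * b * h⁻¹ = a * h * (a * a) * b * h⁻¹ := by rw [ha']; group
        _ = a * h * a * ((a * b) * h⁻¹) := by group
        _ = _ := by rw [← c1.eq]; group
    have f1 := hfin h hh
    have f2 : IsOfFinOrder (a * b) := by simpa using hfin 1 h1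
    have cw : Commute (a * h * a * h⁻¹) (a * b) := c2.mul_left c1
    have e3 : a * h * a * h⁻¹ = (a * h * b * h⁻¹) * (a * b)⁻¹ := by rw [e]; group
    rw [e3]
    refine Commute.isOfFinOrder_mul ?_ f1 f2.inv
    rw [e]
    exact (cw.mul_left (Commute.refl _)).inv_right
  have hcont : ContinuousOn (fun h : UN N => en (a * h * a * h⁻¹)) A :=
    (en_continuous.comp (by fun_prop)).continuousOn
  have hpre := hA.image _ hcont
  have hcount : ((fun h : UN N => en (a * h * a * h⁻¹)) '' A).Countable := by
    refine (countable_traces N).mono ?_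
    rintro _ ⟨h, hh, rfl⟩
    exact ⟨_, hw h hh, rfl⟩
  have hss := hcount.isTotallyDisconnected _ subset_rfl hpre
  have := hss ⟨_, hu, rfl⟩ ⟨1, h1, rfl⟩
  simp only [mul_one, ha', inv_one, en_one] at this
  have := en_eq_zero _ this
  rw [mul_inv_eq_one] at this
  rw [← this]
  calc a * (a * b) * a = (a * a) * b * a := by group
    _ = b * a := by rw [ha', one_mul]

/-- `X` is in the Lie algebra of `G`. -/
def InL {N : ℕ} (G : Subgroup (UN N)) (X : Matrix (Fin N) (Fin N) ℂ) : Prop :=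
  Xᴴ = -X ∧ ∀ t : ℝ, ∃ g ∈ G, (g : Matrix (Fin N) (Fin N) ℂ) = NormedSpace.exp (t • X)

lemma UN_pow_sub {N : ℕ} (r s : UN N) (n : ℕ) :
    ‖(r : Matrix (Fin N) (Fin N) ℂ) ^ n - (s : Matrix (Fin N) (Fin N) ℂ) ^ n‖ ≤
      n * ‖(r : Matrix (Fin N) (Fin N) ℂ) - (s : Matrix (Fin N) (Fin N) ℂ)‖ := by
  induction n with
  | zero => simp
  | succ n ih =>
    have e : (r : Matrix (Fin N) (Fin N) ℂ) ^ (n + 1) - (s : Matrix (Fin N) (Fin N) ℂ) ^ (n + 1)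
      = r * ((r : Matrix (Fin N) (Fin N) ℂ) ^ n - (s : Matrix (Fin N) (Fin N) ℂ) ^ n)
        + ((r : Matrix (Fin N) (Fin N) ℂ) - s) * ((s ^ n : UN N) : Matrix (Fin N) (Fin N) ℂ) := by
      rw [SubmonoidClass.coe_pow, pow_succ', pow_succ']
      noncomm_ring
    rw [e]
    refine (norm_add_le _ _).trans ?_
    rw [CStarRing.norm_coe_unitary_mul]
    have h2 := norm_mul_le ((r : Matrix (Fin N) (Fin N) ℂ) - s)
      ((s ^ n : UN N) : Matrix (Fin N) (Fin N) ℂ)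
    have h3 := UN_norm_le (s ^ n)
    have h4 : ‖(r : Matrix (Fin N) (Fin N) ℂ) - s‖ * ‖((s ^ n : UN N) : Matrix (Fin N) (Fin N) ℂ)‖
      ≤ ‖(r : Matrix (Fin N) (Fin N) ℂ) - s‖ := mul_le_of_le_one_right (norm_nonneg _) h3
    rw [Nat.cast_succ, add_mul, one_mul]
    exact add_le_add ih (h2.trans h4)

lemma exp_skew_mem {N : ℕ} {M : Matrix (Fin N) (Fin N) ℂ} (hM : Mᴴ = -M) (t : ℝ) :
    NormedSpace.exp (t • M) ∈ Matrix.unitaryGroup (Fin N) ℂ := by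
  let _ : NormedAlgebra ℚ (Matrix (Fin N) (Fin N) ℂ) := NormedAlgebra.restrictScalars ℚ ℝ _
  apply NormedSpace.exp_mem_unitary_of_mem_skewAdjoint
  rw [skewAdjoint.mem_iff]
  change (t • M)ᴴ = _
  rw [Matrix.conjTranspose_smul, hM]
  simp

lemma hasDerivAt_expM {N : ℕ} (X : Matrix (Fin N) (Fin N) ℂ) :
    HasDerivAt (fun t : ℝ => NormedSpace.exp (t • X)) X 0 := by
  have h := hasDerivAt_exp_smul_const (𝕂 := ℝ) X 0
  rw [zero_smul, NormedSpace.exp_zero, one_mul] at h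
  exact h

lemma limit_mem {N : ℕ} (G : Subgroup (UN N)) (hG : IsClosed (G : Set (UN N)))
    (r : ℕ → UN N) (hr : ∀ k, r k ∈ G) (hne : ∀ k, r k ≠ 1)
    (hlim : Tendsto (fun k => ‖(r k : Matrix (Fin N) (Fin N) ℂ) - 1‖) atTop (𝓝 0))
    (M : Matrix (Fin N) (Fin N) ℂ)
    (hM : Tendsto (fun k => (‖(r k : Matrix (Fin N) (Fin N) ℂ) - 1‖)⁻¹ •
      ((r k : Matrix (Fin N) (Fin N) ℂ) - 1)) atTop (𝓝 M)) : InL G M := by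
  let _ : NormedAlgebra ℚ (Matrix (Fin N) (Fin N) ℂ) := NormedAlgebra.restrictScalars ℚ ℝ _
  set δ : ℕ → ℝ := fun k => ‖(r k : Matrix (Fin N) (Fin N) ℂ) - 1‖ with hδ
  have hpos : ∀ k, 0 < δ k := fun k => by
    refine norm_pos_iff.2 fun h => hne k ?_
    exact Subtype.ext (sub_eq_zero.1 h)
  set Q : ℕ → Matrix (Fin N) (Fin N) ℂ := fun k => (δ k)⁻¹ • ((r k : Matrix (Fin N) (Fin N) ℂ) - 1)
    with hQ
  have hrQ : ∀ k, (r k : Matrix (Fin N) (Fin N) ℂ) = 1 + δ k • Q k := fun k => by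
    simp only [hQ]
    rw [smul_smul, mul_inv_cancel₀ (hpos k).ne', one_smul]
    abel
  have hskew : Mᴴ = -M := by
    have e : ∀ k, Q k + (Q k)ᴴ = - (δ k • (Q k * (Q k)ᴴ)) := by
      intro k
      have h : (r k : Matrix (Fin N) (Fin N) ℂ) * (r k : Matrix (Fin N) (Fin N) ℂ)ᴴ = 1 :=
        Matrix.mem_unitaryGroup_iff.1 (r k).2
      rw [hrQ k, Matrix.conjTranspose_add, Matrix.conjTranspose_smul, Matrix.conjTranspose_one,
        star_trivial, add_mul, mul_add, mul_add, one_mul, mul_one, one_mul, smul_mul_smul_comm,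
        mul_smul] at h
      have h2 : δ k • (Q k + (Q k)ᴴ + δ k • (Q k * (Q k)ᴴ)) = 0 := by
        rw [smul_add, smul_add]
        have h3 : (1 + δ k • (Q k)ᴴ + (δ k • Q k + δ k • δ k • (Q k * (Q k)ᴴ))) - 1 = 0 := by
          rw [h, sub_self]
        rw [← h3]; abel
      rw [smul_eq_zero] at h2
      exact eq_neg_of_add_eq_zero_left (h2.resolve_left (hpos k).ne')
    have hstar : Tendsto (fun k => (Q k)ᴴ) atTop (𝓝 Mᴴ) :=
      ((continuous_id.matrix_conjTranspose).tendsto M).comp hM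
    have t1 : Tendsto (fun k => Q k + (Q k)ᴴ) atTop (𝓝 (M + Mᴴ)) := hM.add hstar
    have t2 : Tendsto (fun k => - (δ k • (Q k * (Q k)ᴴ))) atTop (𝓝 (-((0 : ℝ) • (M * Mᴴ)))) :=
      (hlim.smul (hM.mul hstar)).neg
    rw [funext e] at t1
    have := tendsto_nhds_unique t1 t2
    rw [zero_smul, neg_zero] at this
    exact eq_neg_of_add_eq_zero_right this
  have hexp : Tendsto (fun k => (δ k)⁻¹ • (NormedSpace.exp (δ k • M) - 1)) atTop (𝓝 M) := by
    have h := (hasDerivAt_expM M).tendsto_slope_zero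
    have h2 : Tendsto δ atTop (𝓝[≠] 0) :=
      tendsto_nhdsWithin_iff.2 ⟨hlim, Eventually.of_forall fun k => (hpos k).ne'⟩
    have h3 := h.comp h2
    simpa [Function.comp_def] using h3
  have key : ∀ t : ℝ, 0 ≤ t → ∃ g ∈ G, (g : Matrix (Fin N) (Fin N) ℂ) = NormedSpace.exp (t • M) := by
    intro t ht
    refine ⟨⟨_, exp_skew_mem hskew t⟩, ?_, rfl⟩
    let n : ℕ → ℕ := fun k => ⌊t / δ k⌋₊
    have hn : Tendsto (fun k => (n k : ℝ) * δ k) atTop (𝓝 t) := by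
      have hl : Tendsto (fun k => t - δ k) atTop (𝓝 t) := by
        simpa using (tendsto_const_nhds (x := t)).sub hlim
      refine tendsto_of_tendsto_of_tendsto_of_le_of_le hl tendsto_const_nhds ?_ ?_
      · intro k
        have := Nat.lt_floor_add_one (t / δ k)
        rw [div_lt_iff₀ (hpos k)] at this
        simp only [n]
        linarith
      · intro k
        have := Nat.floor_le (div_nonneg ht (hpos k).le)
        rw [le_div_iff₀ (hpos k)] at this
        exact this
    have hd : Tendsto (fun k => ((r k ^ n k : UN N) : Matrix (Fin N) (Fin N) ℂ)) atTop
        (𝓝 (NormedSpace.exp (t • M))) := by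
      have hs : Tendsto (fun k => NormedSpace.exp (((n k : ℝ) * δ k) • M)) atTop
          (𝓝 (NormedSpace.exp (t • M))) :=
        (NormedSpace.exp_continuous.tendsto _).comp (hn.smul_const M)
      have hz : Tendsto (fun k => ((n k : ℝ) * δ k) *
          ‖Q k - (δ k)⁻¹ • (NormedSpace.exp (δ k • M) - 1)‖) atTop (𝓝 0) := by
        have := hn.mul (hM.sub hexp).norm
        simpa using this
      have hdiff : Tendsto (fun k => ((r k ^ n k : UN N) : Matrix (Fin N) (Fin N) ℂ) -
          NormedSpace.exp (((n k : ℝ) * δ k) • M)) atTop (𝓝 0) := by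
        refine squeeze_zero_norm (fun k => ?_) hz
        have h := UN_pow_sub (r k) ⟨_, exp_skew_mem hskew (δ k)⟩ (n k)
        have e1 : NormedSpace.exp (((n k : ℝ) * δ k) • M) = NormedSpace.exp (δ k • M) ^ (n k) := by
          rw [← NormedSpace.exp_nsmul, mul_smul, Nat.cast_smul_eq_nsmul]
        rw [e1, SubmonoidClass.coe_pow]
        refine h.trans (le_of_eq ?_)
        have e2 : (r k : Matrix (Fin N) (Fin N) ℂ) - NormedSpace.exp (δ k • M)
          = δ k • (Q k - (δ k)⁻¹ • (NormedSpace.exp (δ k • M) - 1)) := by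
          have e3 : δ k • ((δ k)⁻¹ • (NormedSpace.exp (δ k • M) - 1)) =
              NormedSpace.exp (δ k • M) - 1 := smul_inv_smul₀ (hpos k).ne' _
          rw [smul_sub, e3, hrQ k]
          abel
        simp only [e2]
        rw [norm_smul, Real.norm_of_nonneg (hpos k).le, mul_assoc]
      have := hdiff.add hs
      simpa using this
    have hd' : Tendsto (fun k => r k ^ n k) atTop (𝓝 (⟨_, exp_skew_mem hskew t⟩ : UN N)) :=
      tendsto_subtype_rng.2 hd
    exact hG.mem_of_tendsto hd' (Eventually.of_forall fun k => G.pow_mem (hr k) _)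
  refine ⟨hskew, fun t => ?_⟩
  rcases le_total 0 t with ht | ht
  · exact key t ht
  · obtain ⟨g, hg, he⟩ := key (-t) (by linarith)
    refine ⟨g⁻¹, G.inv_mem hg, ?_⟩
    change (g : Matrix (Fin N) (Fin N) ℂ)ᴴ = _
    rw [he, ← Matrix.exp_conjTranspose, Matrix.conjTranspose_smul, hskew]
    simp

/-- Local injectivity of the projection to the Lie algebra. -/
lemma local_inj {N : ℕ} (G : Subgroup (UN N)) (hG : IsClosed (G : Set (UN N))) :
    ∃ V ∈ 𝓝 (1 : UN N), ∀ y ∈ G, ∀ z ∈ G, y ∈ V → z ∈ V →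
      (∀ X, InL G X → (Matrix.trace (X * (y : Matrix (Fin N) (Fin N) ℂ))).re =
        (Matrix.trace (X * (z : Matrix (Fin N) (Fin N) ℂ))).re) → y = z := by
  by_contra hcon
  push Not at hcon
  obtain ⟨W, hW⟩ := (𝓝 (1 : UN N)).exists_antitone_basis
  have hc := fun k => hcon (W k) (hW.1.mem_of_mem trivial)
  choose y hy z hz hyV hzV hyz hne using hc
  have hyl : Tendsto y atTop (𝓝 1) := hW.tendsto hyV
  have hzl : Tendsto z atTop (𝓝 1) := hW.tendsto hzV
  let r : ℕ → UN N := fun k => (z k)⁻¹ * y k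
  have hrl : Tendsto r atTop (𝓝 1) := by
    have := hzl.inv.mul hyl
    simpa using this
  have hrne : ∀ k, r k ≠ 1 := fun k h => hne k (inv_mul_eq_one.1 h).symm
  have hrG : ∀ k, r k ∈ G := fun k => G.mul_mem (G.inv_mem (hz k)) (hy k)
  have hrl' : Tendsto (fun k => ‖(r k : Matrix (Fin N) (Fin N) ℂ) - 1‖) atTop (𝓝 0) := by
    have h1 : Tendsto (fun k => (r k : Matrix (Fin N) (Fin N) ℂ)) atTop (𝓝 1) :=
      tendsto_subtype_rng.1 hrl
    have := (h1.sub (tendsto_const_nhds (x := (1 : Matrix (Fin N) (Fin N) ℂ)))).norm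
    simpa using this
  have hpos : ∀ k, ‖(r k : Matrix (Fin N) (Fin N) ℂ) - 1‖ ≠ 0 := fun k => by
    refine norm_ne_zero_iff.2 fun h => hrne k ?_
    exact Subtype.ext (sub_eq_zero.1 h)
  let Q : ℕ → Matrix (Fin N) (Fin N) ℂ := fun k =>
    (‖(r k : Matrix (Fin N) (Fin N) ℂ) - 1‖)⁻¹ • ((r k : Matrix (Fin N) (Fin N) ℂ) - 1)
  have hQ1 : ∀ k, ‖Q k‖ = 1 := fun k => by
    simp only [Q]
    rw [norm_smul, norm_inv, norm_norm, inv_mul_cancel₀ (hpos k)]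
  obtain ⟨M, hM, φ, hφ, hlim⟩ := (isCompact_sphere (0 : Matrix (Fin N) (Fin N) ℂ) 1).tendsto_subseq
    (x := Q) (fun k => by simp [hQ1 k])
  have hL : InL G M := limit_mem G hG (r ∘ φ) (fun k => hrG _) (fun k => hrne _)
    (hrl'.comp hφ.tendsto_atTop) M hlim
  have hzl' : Tendsto (fun k => (z (φ k) : Matrix (Fin N) (Fin N) ℂ)) atTop (𝓝 1) :=
    tendsto_subtype_rng.1 (hzl.comp hφ.tendsto_atTop)
  have e : ∀ k, (Matrix.trace (M * ((z k : Matrix (Fin N) (Fin N) ℂ) * Q k))).re = 0 := by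
    intro k
    have e1 : (z k : Matrix (Fin N) (Fin N) ℂ) * ((r k : Matrix (Fin N) (Fin N) ℂ) - 1) =
        (y k : Matrix (Fin N) (Fin N) ℂ) - z k := by
      have : (y k) = z k * r k := by simp [r]
      rw [mul_sub, mul_one, this]
      rfl
    simp only [Q]
    rw [mul_smul_comm, mul_smul_comm, e1, Matrix.trace_smul, mul_sub, Matrix.trace_sub]
    rw [Complex.smul_re, Complex.sub_re, hyz k M hL, sub_self, smul_zero]
  have hcts : Continuous fun A : Matrix (Fin N) (Fin N) ℂ => (Matrix.trace (M * A)).re :=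
    Complex.continuous_re.comp ((continuous_const.mul continuous_id).matrix_trace)
  have tl := (hcts.tendsto _).comp (hzl'.mul hlim)
  have tl0 : Tendsto ((fun A : Matrix (Fin N) (Fin N) ℂ => (Matrix.trace (M * A)).re) ∘
      fun k => (z (φ k) : Matrix (Fin N) (Fin N) ℂ) * (Q ∘ φ) k) atTop (𝓝 0) := by
    refine tendsto_const_nhds.congr fun k => ?_
    exact (e (φ k)).symm
  have h0 := tendsto_nhds_unique tl tl0
  simp only [one_mul] at h0
  have : M = 0 := by
    apply eq_zero_of_trace_re
    rw [hL.1, neg_mul, Matrix.trace_neg, Complex.neg_re, h0, neg_zero]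
  rw [this] at hM
  simp at hM

lemma hasDerivAt_tr {N : ℕ} (X A : Matrix (Fin N) (Fin N) ℂ) :
    HasDerivAt (fun t : ℝ => (Matrix.trace (NormedSpace.exp (t • X) * A)).re)
      (Matrix.trace (X * A)).re 0 := by
  let L : Matrix (Fin N) (Fin N) ℂ →ₗ[ℝ] ℝ :=
    { toFun := fun B => (Matrix.trace (B * A)).re
      map_add' := fun B C => by rw [add_mul, Matrix.trace_add, Complex.add_re]
      map_smul' := fun c B => by
        rw [smul_mul_assoc, Matrix.trace_smul, Complex.smul_re]; rfl }
  exact (LinearMap.toContinuousLinearMap L).hasFDerivAt.comp_hasDerivAt 0 (hasDerivAt_expM X)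

lemma en_cont_inv_mul {N : ℕ} (u : UN N) : Continuous fun v : UN N => en (v⁻¹ * u) :=
  Continuous.comp (f := fun v : UN N => v⁻¹ * u) en_continuous
    (continuous_inv.mul continuous_const)

lemma sum_en_take {N : ℕ} (l : List (UN N)) :
    ∑ i ∈ Finset.range l.length, en ((l.take i).prod⁻¹ * (l.take (i + 1)).prod)
      = (l.map en).sum := by
  rw [Finset.sum_range, ← Fin.sum_univ_fun_getElem]
  refine Finset.sum_congr rfl fun i _ => ?_
  rw [List.prod_take_succ _ _ i.2]
  simp

lemma InL.trace_re {N : ℕ} {G : Subgroup (UN N)} {X : Matrix (Fin N) (Fin N) ℂ} (hX : InL G X) :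
    (Matrix.trace X).re = 0 := by
  have h := congrArg (fun A => (Matrix.trace A).re) hX.1
  simp only [Matrix.trace_conjTranspose, Matrix.trace_neg, Complex.star_def, Complex.conj_re,
    Complex.neg_re] at h
  linarith

/-- Elements reachable by chains in `G` of arbitrarily small total energy. -/
def E0 {N : ℕ} (G : Subgroup (UN N)) : Subgroup (UN N) where
  carrier := {u | ∀ ε : ℝ, 0 < ε → ∃ l : List (UN N), (∀ x ∈ l, x ∈ G) ∧ l.prod = u ∧
    (l.map en).sum < ε}
  one_mem' := fun ε hε => ⟨[], by simp, by simp, by simpa using hε⟩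
  mul_mem' := by
    intro u v hu hv ε hε
    obtain ⟨l, h1, h2, h3⟩ := hu (ε / 2) (by linarith)
    obtain ⟨m, k1, k2, k3⟩ := hv (ε / 2) (by linarith)
    refine ⟨l ++ m, ?_, by rw [List.prod_append, h2, k2], ?_⟩
    · intro x hx
      rcases List.mem_append.1 hx with h | h
      · exact h1 x h
      · exact k1 x h
    · rw [List.map_append, List.sum_append]; linarith
  inv_mem' := by
    intro u hu ε hε
    obtain ⟨l, h1, h2, h3⟩ := hu ε hε
    refine ⟨(l.map (fun x => x⁻¹)).reverse, ?_, by rw [← List.prod_inv_reverse, h2], ?_⟩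
    · intro x hx
      rw [List.mem_reverse, List.mem_map] at hx
      obtain ⟨y, hy, rfl⟩ := hx
      exact G.inv_mem (h1 y hy)
    · rw [List.map_reverse, List.sum_reverse, List.map_map]
      have : (en ∘ fun x : UN N => x⁻¹) = en := funext fun x => en_inv x
      rw [this]; exact h3

lemma E0_le {N : ℕ} (G : Subgroup (UN N)) : E0 G ≤ G := by
  intro u hu
  obtain ⟨l, h1, h2, -⟩ := hu 1 one_pos
  rw [← h2]
  exact G.list_prod_mem h1

lemma E0_closed {N : ℕ} (G : Subgroup (UN N)) (hG : IsClosed (G : Set (UN N))) :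
    IsClosed (E0 G : Set (UN N)) := by
  refine isClosed_of_closure_subset fun u hu ε hε => ?_
  have huG : u ∈ G := closure_minimal (show (E0 G : Set (UN N)) ⊆ G from E0_le G) hG hu
  have hc := en_cont_inv_mul u
  have hn : {v : UN N | en (v⁻¹ * u) < ε / 2} ∈ 𝓝 u := by
    refine (isOpen_lt hc continuous_const).mem_nhds ?_
    simp only [Set.mem_ofPred_eq, inv_mul_cancel, en_one]
    linarith
  obtain ⟨v, hv, hvE⟩ := mem_closure_iff_nhds.1 hu _ hn
  obtain ⟨l, h1, h2, h3⟩ := hvE (ε / 2) (by linarith)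
  refine ⟨l ++ [v⁻¹ * u], ?_, by rw [List.prod_append, h2]; simp, ?_⟩
  · intro x hx
    rcases List.mem_append.1 hx with h | h
    · exact h1 x h
    · rw [List.mem_singleton.1 h]
      exact G.mul_mem (G.inv_mem (E0_le G hvE)) huG
  · rw [List.map_append, List.sum_append]
    have : en (v⁻¹ * u) < ε / 2 := hv
    simp only [List.map_cons, List.map_nil, List.sum_cons, List.sum_nil]
    linarith

lemma E0_exp {N : ℕ} (G : Subgroup (UN N)) (X : Matrix (Fin N) (Fin N) ℂ) (hX : InL G X)
    (t : ℝ) (g : UN N) (hg : (g : Matrix (Fin N) (Fin N) ℂ) = NormedSpace.exp (t • X)) :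
    g ∈ E0 G := by
  let _ : NormedAlgebra ℚ (Matrix (Fin N) (Fin N) ℂ) := NormedAlgebra.restrictScalars ℚ ℝ _
  intro ε hε
  let f : ℝ → ℝ := fun s => (N : ℝ) - (Matrix.trace (NormedSpace.exp (s • X))).re
  have hf : HasDerivAt f 0 0 := by
    have h := (hasDerivAt_tr X 1).const_sub (N : ℝ)
    simp only [mul_one, hX.trace_re, neg_zero] at h
    exact h
  have hf0 : f 0 = 0 := by simp [f]
  have hf2 : HasDerivAt (fun s => f (s * t)) 0 0 := by
    have h := HasDerivAt.comp (h₂ := f) (h := fun s : ℝ => s * t) (x := 0) (h₂' := 0) (h' := t)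
      (by simpa using hf) (by simpa using (hasDerivAt_id (0 : ℝ)).mul_const t)
    simpa [Function.comp_def] using h
  have h1 := hf2.tendsto_slope_zero
  have h2 : Tendsto (fun k : ℕ => ((k : ℝ) + 1)⁻¹) atTop (𝓝[≠] 0) := by
    refine tendsto_nhdsWithin_iff.2 ⟨?_, Eventually.of_forall fun k => ?_⟩
    · simpa [one_div] using tendsto_one_div_add_atTop_nhds_zero_nat (𝕜 := ℝ)
    · have : (0 : ℝ) < ((k : ℝ) + 1)⁻¹ := by positivity
      exact this.ne'
  have h3 := h1.comp h2
  obtain ⟨k, hk⟩ := (h3.eventually (gt_mem_nhds hε)).exists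
  simp only [Function.comp, inv_inv, zero_add, zero_mul, hf0, sub_zero, smul_eq_mul] at hk
  obtain ⟨y, hy, hye⟩ := hX.2 (((k : ℝ) + 1)⁻¹ * t)
  refine ⟨List.replicate (k + 1) y, ?_, ?_, ?_⟩
  · intro x hx
    rw [List.eq_of_mem_replicate hx]; exact hy
  · rw [List.prod_replicate]
    apply Subtype.ext
    rw [SubmonoidClass.coe_pow, hye, hg, ← NormedSpace.exp_nsmul, ← Nat.cast_smul_eq_nsmul ℝ,
      smul_smul]
    congr 2
    have : (k : ℝ) + 1 ≠ 0 := by positivity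
    push_cast
    field_simp
  · rw [List.map_replicate, List.sum_replicate, nsmul_eq_mul]
    have : en y = f (((k : ℝ) + 1)⁻¹ * t) := by simp only [en, hye, f]
    rw [this]
    push_cast
    exact hk

lemma E0_eq {N : ℕ} (G : Subgroup (UN N)) (hG : IsClosed (G : Set (UN N)))
    (hconn : IsConnected (G : Set (UN N))) : G ≤ E0 G := by
  have := UN_compact N
  obtain ⟨V, hV, hinj⟩ := local_inj G hG
  obtain ⟨ε, hε, hsm⟩ := en_small V hV
  have hloc : ∀ g ∈ G, en g < ε → g ∈ E0 G := by
    intro g hg hge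
    have hc := en_cont_inv_mul g
    obtain ⟨h, hh, hmin⟩ := (E0_closed G hG).isCompact.exists_isMinOn ⟨1, (E0 G).one_mem⟩
      hc.continuousOn
    have hr : en (h⁻¹ * g) ≤ en g := by
      have := hmin (E0 G).one_mem
      simpa using this
    have heq : h⁻¹ * g = 1 := by
      refine hinj _ (G.mul_mem (G.inv_mem (E0_le G hh)) hg) 1 G.one_mem
        (hsm _ (lt_of_le_of_lt hr hge)) (mem_of_mem_nhds hV) ?_
      intro X hX
      have hmax : IsLocalMax (fun t : ℝ => (Matrix.trace (NormedSpace.exp (t • X) *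
          ((h⁻¹ * g : UN N) : Matrix (Fin N) (Fin N) ℂ))).re) 0 := by
        refine Eventually.of_forall fun t => ?_
        obtain ⟨e, heG, he⟩ := hX.2 t
        have heE := E0_exp G X hX t e he
        have h1 : en (h⁻¹ * g) ≤ en ((h * e⁻¹)⁻¹ * g) :=
          hmin ((E0 G).mul_mem hh ((E0 G).inv_mem heE))
        have h2 : (h * e⁻¹)⁻¹ * g = e * (h⁻¹ * g) := by group
        have h3 : ((e * (h⁻¹ * g) : UN N) : Matrix (Fin N) (Fin N) ℂ) =
          NormedSpace.exp (t • X) * ((h⁻¹ * g : UN N) : Matrix (Fin N) (Fin N) ℂ) := by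
          rw [← he]; rfl
        rw [h2, en, en, h3] at h1
        simp only [zero_smul, NormedSpace.exp_zero, one_mul]
        linarith
      rw [hmax.hasDerivAt_eq_zero (hasDerivAt_tr X _)]
      simp [hX.trace_re]
    have : g = h := (inv_mul_eq_one.1 heq).symm
    rw [this]; exact hh
  have : ConnectedSpace G := isConnected_iff_connectedSpace.1 hconn
  let H : Subgroup G := (E0 G).subgroupOf G
  have hop : IsOpen (H : Set G) := by
    refine H.isOpen_of_mem_nhds (g := 1) ?_
    have hc : Continuous fun g : G => en (g : UN N) := en_continuous.comp continuous_subtype_val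
    have hn : {g : G | en (g : UN N) < ε} ∈ 𝓝 (1 : G) := by
      refine (isOpen_lt hc continuous_const).mem_nhds ?_
      simpa [en_one] using hε
    filter_upwards [hn] with g hg
    exact hloc g g.2 hg
  have hcl : IsClosed (H : Set G) := (E0_closed G hG).preimage continuous_subtype_val
  have huniv : (H : Set G) = Set.univ := IsClopen.eq_univ ⟨hcl, hop⟩ ⟨1, H.one_mem⟩
  intro g hg
  have : (⟨g, hg⟩ : G) ∈ (H : Set G) := by rw [huniv]; trivial
  exact this

/-- Every element of `G` has roots in `G` arbitrarily close to `1`. -/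
lemma small_root {N : ℕ} (G : Subgroup (UN N)) (hG : IsClosed (G : Set (UN N)))
    (hconn : IsConnected (G : Set (UN N))) (u : UN N) (hu : u ∈ G) (V : Set (UN N))
    (hV : V ∈ 𝓝 1) : ∃ y ∈ G, y ∈ V ∧ ∃ n : ℕ, y ^ n = u := by
  have := UN_compact N
  obtain ⟨V₀, hV₀, hinj⟩ := local_inj G hG
  obtain ⟨ε, hε, hsm⟩ := en_small (V ∩ V₀) (inter_mem hV hV₀)
  obtain ⟨l, hlG, hlu, hle⟩ := E0_eq G hG hconn hu ε hε
  set n := l.length with hn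
  rcases Nat.eq_zero_or_pos n with h0 | hnpos
  · refine ⟨1, G.one_mem, mem_of_mem_nhds hV, 0, ?_⟩
    rw [List.length_eq_zero_iff.1 h0] at hlu
    simpa using hlu
  let K : Set (ℕ → UN N) := {x | (∀ i, x i ∈ G) ∧ x 0 = 1 ∧ x n = u}
  let F : (ℕ → UN N) → ℝ := fun x => ∑ i ∈ Finset.range n, en ((x i)⁻¹ * x (i + 1))
  have hF : Continuous F :=
    continuous_finsetSum _ fun i _ => en_continuous.comp (by fun_prop)
  have hK : IsClosed K := by
    have e : K = (⋂ i, (fun x : ℕ → UN N => x i) ⁻¹' (G : Set (UN N))) ∩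
      ({x | x 0 = 1} ∩ {x | x n = u}) := by
      ext x; simp [K]
    rw [e]
    refine (isClosed_iInter fun i => hG.preimage (continuous_apply i)).inter ?_
    exact (isClosed_eq (continuous_apply 0) continuous_const).inter
      (isClosed_eq (continuous_apply n) continuous_const)
  let x₀ : ℕ → UN N := fun i => (l.take i).prod
  have hx₀ : x₀ ∈ K := by
    refine ⟨fun i => G.list_prod_mem fun x hx => hlG x (List.mem_of_mem_take hx), by simp [x₀], ?_⟩
    simp only [x₀, hn, List.take_length, hlu]
  have hFx₀ : F x₀ = (l.map en).sum := sum_en_take l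
  obtain ⟨x, hxK, hmin⟩ := hK.isCompact.exists_isMinOn ⟨x₀, hx₀⟩ hF.continuousOn
  have hFx : F x < ε := lt_of_le_of_lt (hmin hx₀) (by rw [hFx₀]; exact hle)
  let y : ℕ → UN N := fun i => (x i)⁻¹ * x (i + 1)
  have hyG : ∀ i, y i ∈ G := fun i => G.mul_mem (G.inv_mem (hxK.1 _)) (hxK.1 _)
  have hyV : ∀ i < n, y i ∈ V ∩ V₀ := by
    intro i hi
    refine hsm _ (lt_of_le_of_lt ?_ hFx)
    exact Finset.single_le_sum (f := fun i => en ((x i)⁻¹ * x (i + 1)))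
      (fun j _ => en_nonneg _) (Finset.mem_range.2 hi)
  have hstep : ∀ i, i + 1 < n → y i = y (i + 1) := by
    intro i hi
    refine hinj _ (hyG _) _ (hyG _) (hyV i (by omega)).2 (hyV (i + 1) hi).2 ?_
    intro X hX
    have hmax : IsLocalMax (fun t : ℝ =>
        (Matrix.trace (NormedSpace.exp (t • X) * (y i : Matrix (Fin N) (Fin N) ℂ))).re +
        (Matrix.trace (NormedSpace.exp (t • (-X)) *
          (y (i + 1) : Matrix (Fin N) (Fin N) ℂ))).re) 0 := by
      refine Eventually.of_forall fun t => ?_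
      obtain ⟨e, heG, he⟩ := hX.2 t
      let x' : ℕ → UN N := Function.update x (i + 1) (x (i + 1) * e)
      have hx'K : x' ∈ K := by
        refine ⟨fun j => ?_, ?_, ?_⟩
        · by_cases hj : j = i + 1
          · subst hj
            simp only [x', Function.update_self]
            exact G.mul_mem (hxK.1 _) heG
          · simp only [x', Function.update_of_ne hj]
            exact hxK.1 j
        · simp only [x']
          rw [Function.update_of_ne (by omega)]
          exact hxK.2.1
        · simp only [x']
          rw [Function.update_of_ne (by omega)]
          exact hxK.2.2
      have h1 : F x ≤ F x' := hmin hx'K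
      have h2 : F x' - F x = (en (y i * e) - en (y i)) + (en (e⁻¹ * y (i + 1)) - en (y (i + 1))) := by
        simp only [F]
        rw [← Finset.sum_sub_distrib, Finset.sum_eq_add_of_mem i (i + 1)
          (Finset.mem_range.2 (by omega)) (Finset.mem_range.2 hi) (by omega)]
        · simp only [x', y]
          rw [Function.update_self, Function.update_of_ne (by omega), Function.update_of_ne (by omega)]
          congr 3
          · group
          · group
        · intro j _ hj
          simp only [x']
          rw [Function.update_of_ne (by omega), Function.update_of_ne (by omega), sub_self]
      have e1 : (Matrix.trace ((y i * e : UN N) : Matrix (Fin N) (Fin N) ℂ)) =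
          Matrix.trace (NormedSpace.exp (t • X) * (y i : Matrix (Fin N) (Fin N) ℂ)) := by
        rw [← he, Matrix.trace_mul_comm]; rfl
      have e2 : (((e⁻¹ * y (i + 1) : UN N)) : Matrix (Fin N) (Fin N) ℂ) =
          NormedSpace.exp (t • (-X)) * (y (i + 1) : Matrix (Fin N) (Fin N) ℂ) := by
        have : t • (-X) = (t • X)ᴴ := by
          rw [Matrix.conjTranspose_smul, hX.1, star_trivial]
        rw [this, Matrix.exp_conjTranspose, ← he]
        rfl
      simp only [en, e1, e2] at h2
      simp only [zero_smul, NormedSpace.exp_zero, one_mul]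
      linarith
    have := hmax.hasDerivAt_eq_zero ((hasDerivAt_tr X _).add (hasDerivAt_tr (-X) _))
    rw [neg_mul, Matrix.trace_neg, Complex.neg_re] at this
    linarith
  have hconst : ∀ i < n, y i = y 0 := by
    intro i
    induction i with
    | zero => intro _; rfl
    | succ i ih => intro hi; rw [← hstep i hi, ih (by omega)]
  have hpow : ∀ i ≤ n, x i = y 0 ^ i := by
    intro i
    induction i with
    | zero => intro _; rw [pow_zero]; exact hxK.2.1
    | succ i ih =>
      intro hi
      rw [pow_succ, ← ih (by omega), ← hconst i (by omega)]
      simp [y]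
  exact ⟨y 0, hyG 0, (hyV 0 hnpos).1, n, by rw [← hpow n le_rfl]; exact hxK.2.2⟩

/-- If `G` is a closed connected subgroup of `U(N)` and `a`, `b` are involutions
in `G` such that `a * g * b * g⁻¹` has finite order for every `g ∈ G`, then `a`
and `b` commute. -/
theorem involutions_commute_aux (N : ℕ)
    (G : Subgroup (Matrix.unitaryGroup (Fin N) ℂ))
    (hclosed : IsClosed (G : Set (Matrix.unitaryGroup (Fin N) ℂ)))
    (hconn : IsConnected (G : Set (Matrix.unitaryGroup (Fin N) ℂ)))
    (a b : Matrix.unitaryGroup (Fin N) ℂ) (haG : a ∈ G) (hbG : b ∈ G)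
    (ha : a ^ 2 = 1) (hb : b ^ 2 = 1)
    (hfin : ∀ g ∈ G, IsOfFinOrder (a * g * b * g⁻¹)) :
    a * b = b * a := by
  have := UN_compact N
  have huG : a * b ∈ G := G.mul_mem haG hbG
  let Z : Subgroup (UN N) := G ⊓ Subgroup.centralizer {a * b}
  have hZc : ∀ h, h ∈ Z ↔ h ∈ G ∧ h * (a * b) = (a * b) * h := by
    intro h
    simp only [Z, Subgroup.mem_inf, Subgroup.mem_centralizer_singleton_iff]
    try rw [eq_comm (a := a * b * h)]
  have hZcl : IsClosed (Z : Set (UN N)) := by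
    have e : (Z : Set (UN N)) = (G : Set (UN N)) ∩ {h : UN N | h * (a * b) = (a * b) * h} := by
      ext h; exact hZc h
    rw [e]
    exact hclosed.inter (isClosed_eq (continuous_id.mul continuous_const)
      (continuous_const.mul continuous_id))
  have : CompactSpace Z := isCompact_iff_compactSpace.1 hZcl.isCompact
  have huZ : a * b ∈ Z := (hZc _).2 ⟨huG, rfl⟩
  have hmem : (⟨a * b, huZ⟩ : Z) ∈ connectedComponent (1 : Z) := by
    rw [connectedComponent_eq_iInter_isClopen, Set.mem_iInter]
    rintro ⟨F, hF, h1⟩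
    obtain ⟨W, hW, hFW⟩ := compact_open_separated_mul_right hF.1.isCompact hF.2 subset_rfl
    rw [nhds_subtype_eq_comap, mem_comap] at hW
    obtain ⟨V, hV, hVW⟩ := hW
    obtain ⟨y, hyG, hyV, n, hyn⟩ := small_root G hclosed hconn (a * b) huG V hV
    have hyZ : y ∈ Z := (hZc y).2 ⟨hyG, by rw [← hyn]; exact (Commute.self_pow y n).eq⟩
    have hp : ∀ k : ℕ, (⟨y, hyZ⟩ : Z) ^ k ∈ F := by
      intro k
      induction k with
      | zero => rw [pow_zero]; exact h1
      | succ k ih =>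
        rw [pow_succ]
        exact hFW (Set.mul_mem_mul ih (hVW hyV))
    have := hp n
    have e : (⟨y, hyZ⟩ : Z) ^ n = ⟨a * b, huZ⟩ := Subtype.ext hyn
    rwa [e] at this
  refine final_step a b ha hb (Subtype.val '' connectedComponent (1 : Z))
    (isPreconnected_connectedComponent.image _ continuous_subtype_val.continuousOn)
    ⟨1, mem_connectedComponent, rfl⟩ ⟨_, hmem, rfl⟩ ?_ ?_
  · rintro _ ⟨h, _, rfl⟩
    exact ((hZc _).1 h.2).2
  · rintro _ ⟨h, _, rfl⟩
    exact hfin _ ((hZc _).1 h.2).1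

end Helpers

/-- If `G` is a closed connected subgroup of `U(N)` and `a`, `b` are involutions
in `G` such that `a * g * b * g⁻¹` has finite order for every `g ∈ G`, then `a`
and `b` commute. -/
theorem involutions_commute_of_finite_order_conj (N : ℕ) (hN : 1 ≤ N)
    (G : Subgroup (Matrix.unitaryGroup (Fin N) ℂ))
    (hclosed : IsClosed (G : Set (Matrix.unitaryGroup (Fin N) ℂ)))
    (hconn : IsConnected (G : Set (Matrix.unitaryGroup (Fin N) ℂ)))
    (a b : Matrix.unitaryGroup (Fin N) ℂ) (haG : a ∈ G) (hbG : b ∈ G)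
    (ha : a ^ 2 = 1) (hb : b ^ 2 = 1)
    (hfin : ∀ g ∈ G, IsOfFinOrder (a * g * b * g⁻¹)) :
    a * b = b * a := by
  exact involutions_commute_aux N G hclosed hconn a b haG hbG ha hb hfin
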